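/- Let k ≥ 2, n = k+3, H = ℂ² ⊗ ℂ^k. Let p_r ∈ B(ℂ^k) be the orthogonal projection onto ℂe_r (e₁,…,e_k the standard basis), let v̂_i ∈ B(ℂ^k) (1 ≤ i ≤ k−1) be the unitary swapping e_i and e_{i+1} and fixing all other basis vectors, let p̊ = [[1,0],[0,0]] and q̊ = (1/2)[[1,1],[1,1]] in M₂(ℂ), and set v_i := 1 ⊗ v̂_i, p := p̊ ⊗ p₁, q := q̊ ⊗ p_k in B(H). Define the n×n matrix (u'_{ij}) over B(H) to be block diagonal with diagonal blocks v₁,…,v_{k−1}, then the 2×2 block [[p, 1−p],[1−p, p]], then the 2×2 block [[q, 1−q],[1−q, q]], and all other entries 0. Then: (i) every u'_{ij} is self-adjoint; (iii) u'_{ik}u'_{jk} = u'_{ki}u'_{kj} = 0 for all i ≠ j and all k; (iv) ∑_k u'_{ik}² = ∑_k u'_{ki}² = 1 for all i; (ii) for every 2 ≤ l ≤ k and all multi-indices i, j of length l, the elements u'_{i₂j₂} ⋯ u'_{i_l j_l}² ⋯ u'_{i₂j₂} and u'_{i₁j₁}² commute; but there exist multi-indices i, j of length k+1 such that u'_{i₂j₂}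 ⋯ u'_{i_{k+1} j_{k+1}}² ⋯ u'_{i₂j₂} and u'_{i₁j₁}² do not commute. -/

import Mathlib

open Kronecker Matrix

namespace EasyQG19

/-- Operators on `ℂ² ⊗ ℂ^k`, identified with matrices indexed by `Fin 2 × Fin k`. -/
abbrev Mk (k : ℕ) := Matrix (Fin 2 × Fin k) (Fin 2 × Fin k) ℂ

/-- The orthogonal projection of `ℂ^k` onto `ℂ e_r` (0-based index `r`). -/
noncomputable def projMat (k : ℕ) (r : ℕ) : Matrix (Fin k) (Fin k) ℂ :=
  Matrix.of fun x y => if x.val = r ∧ y.val = r then 1 else 0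

/-- The unitary of `ℂ^k` swapping `e_m` and `e_{m+1}` (0-based) and fixing all
other basis vectors. -/
noncomputable def swapMat (k : ℕ) (m : ℕ) : Matrix (Fin k) (Fin k) ℂ :=
  Matrix.of fun x y =>
    if (x.val = m ∧ y.val = m + 1) ∨ (x.val = m + 1 ∧ y.val = m) ∨
        (x = y ∧ x.val ≠ m ∧ x.val ≠ m + 1) then 1 else 0

/-- The projection `p̊ = [[1,0],[0,0]]`. -/
noncomputable def pSmall : Matrix (Fin 2) (Fin 2) ℂ := !![1, 0; 0, 0]

/-- The projection `q̊ = (1/2)[[1,1],[1,1]]`. -/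
noncomputable def qSmall : Matrix (Fin 2) (Fin 2) ℂ := !![1/2, 1/2; 1/2, 1/2]

/-- `p = p̊ ⊗ p₁`. -/
noncomputable def P (k : ℕ) : Mk k := pSmall ⊗ₖ projMat k 0

/-- `q = q̊ ⊗ p_k`. -/
noncomputable def Q (k : ℕ) : Mk k := qSmall ⊗ₖ projMat k (k - 1)

/-- `v_i = 1 ⊗ v̂_i` (with 0-based `i`, swapping `e_i` and `e_{i+1}`). -/
noncomputable def V (k m : ℕ) : Mk k := (1 : Matrix (Fin 2) (Fin 2) ℂ) ⊗ₖ swapMat k m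

/-- The `(k+3) × (k+3)` matrix of operators which is block diagonal with
diagonal blocks `v₁, …, v_{k-1}`, then `[[p, 1-p],[1-p, p]]`, then
`[[q, 1-q],[1-q, q]]`, and all other entries `0`. -/
noncomputable def U (k : ℕ) (i j : Fin (k + 3)) : Mk k :=
  if i.val < k - 1 then (if j = i then V k i.val else 0)
  else if i.val = k - 1 then
    (if j.val = k - 1 then P k else if j.val = k then 1 - P k else 0)
  else if i.val = k then
    (if j.val = k - 1 then 1 - P k else if j.val = k then P k else 0)
  else if i.val = k + 1 then
    (if j.val = k + 1 then Q k else if j.val = k + 2 then 1 - Q k else 0)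
  else (if j.val = k + 1 then 1 - Q k else if j.val = k + 2 then Q k else 0)

/-- `nest [m₂, …, m_l] = m₂ ⋯ m_{l-1} m_l m_l m_{l-1} ⋯ m₂`, the sandwiched
product `u'_{i₂j₂} ⋯ u'_{i_l j_l}² ⋯ u'_{i₂j₂}`. -/
noncomputable def nest (k : ℕ) : List (Mk k) → Mk k
  | [] => 1
  | m :: ms => m * nest k ms * m

/-- The permutation of `Fin 2 × Fin k` swapping the levels `m` and `m+1`. -/
def sw (k m : ℕ) (h : m + 1 < k) : Equiv.Perm (Fin k) :=
  Equiv.swap ⟨m, by omega⟩ ⟨m + 1, h⟩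

def sw2 (k m : ℕ) (h : m + 1 < k) : Equiv.Perm (Fin 2 × Fin k) :=
  (Equiv.refl _).prodCongr (sw k m h)

lemma sw_val (k m : ℕ) (h : m + 1 < k) (x : Fin k) :
    (sw k m h x).val = if x.val = m then m + 1 else if x.val = m + 1 then m else x.val := by
  unfold sw
  rw [Equiv.swap_apply_def]
  simp only [Fin.ext_iff]
  split_ifs <;> rfl

lemma V_eq (k m : ℕ) (h : m + 1 < k) :
    V k m = (1 : Mk k).submatrix (sw2 k m h) (Equiv.refl _) := by
  ext ⟨a, x⟩ ⟨b, y⟩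
  have h2 := sw_val k m h x
  simp only [V, swapMat, kroneckerMap_apply, Matrix.submatrix_apply, Matrix.one_apply, sw2,
    Matrix.of_apply, Equiv.prodCongr_apply, Prod.map, Equiv.refl_apply, Prod.mk.injEq,
    Fin.ext_iff, h2]
  by_cases hab : a.val = b.val
  · simp only [hab, true_and, if_true, one_mul]
    refine if_congr ?_ rfl rfl
    split_ifs <;> omega
  · simp [hab]

lemma V_eq' (k m : ℕ) (h : m + 1 < k) :
    V k m = (1 : Mk k).submatrix (Equiv.refl _) (sw2 k m h) := by
  rw [V_eq k m h]
  ext a b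
  have hi : sw2 k m h (sw2 k m h a) = a := by
    ext <;> simp [sw2, sw]
  simp only [Matrix.submatrix_apply, Matrix.one_apply, Equiv.refl_apply]
  refine if_congr ?_ rfl rfl
  constructor
  · rintro rfl; exact hi.symm
  · rintro rfl
    ext <;> simp [sw2, sw]

lemma V_conj (k m : ℕ) (h : m + 1 < k) (A : Fin k → Matrix (Fin 2) (Fin 2) ℂ) :
    V k m * blockDiagonal A * V k m = blockDiagonal (fun x => A (sw k m h x)) := by
  have h1 : V k m * blockDiagonal A * V k m =
      (blockDiagonal A).submatrix (sw2 k m h) (sw2 k m h) := by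
    conv_lhs => rw [V_eq k m h]
    rw [← V_eq k m h]
    nth_rewrite 1 [V_eq k m h]
    rw [V_eq' k m h]
    ext a b
    simp [Matrix.mul_apply, Matrix.one_apply]
  rw [h1]
  ext ⟨a, x⟩ ⟨b, y⟩
  simp [blockDiagonal_apply, sw2]

lemma V_sq (k m : ℕ) (h : m + 1 < k) : V k m * V k m = 1 := by
  have := V_conj k m h 1
  rw [blockDiagonal_one, mul_one] at this
  rw [this]
  exact blockDiagonal_one

lemma V_herm (k m : ℕ) : (V k m)ᴴ = V k m := by
  ext ⟨a, x⟩ ⟨b, y⟩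
  simp only [V, swapMat, conjTranspose_apply, kroneckerMap_apply, Matrix.one_apply,
    Matrix.of_apply, Fin.ext_iff, star_mul']
  rw [apply_ite star, apply_ite star, star_one, star_zero]
  congr 1
  · exact if_congr eq_comm rfl rfl
  · refine if_congr ?_ rfl rfl
    omega

lemma kron_eq (k r : ℕ) (a : Matrix (Fin 2) (Fin 2) ℂ) :
    a ⊗ₖ projMat k r = blockDiagonal (fun x : Fin k => if x.val = r then a else 0) := by
  ext ⟨b, x⟩ ⟨c, y⟩
  simp only [projMat, kroneckerMap_apply, Matrix.of_apply, blockDiagonal_apply, Fin.ext_iff]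
  by_cases hx : x.val = r
  · by_cases hy : y.val = r
    · simp [hx, hy]
    · have : ¬ r = y.val := fun h => hy h.symm
      simp [hx, hy, this]
  · simp [hx]

lemma one_sub_bd (k : ℕ) (A : Fin k → Matrix (Fin 2) (Fin 2) ℂ) :
    1 - blockDiagonal A = blockDiagonal (fun x => 1 - A x) := by
  rw [← blockDiagonal_one, ← blockDiagonal_sub]; rfl

lemma p_sq : pSmall * pSmall = pSmall := by
  ext i j; fin_cases i <;> fin_cases j <;> simp [pSmall, Matrix.mul_apply]

lemma q_sq : qSmall * qSmall = qSmall := by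
  ext i j; fin_cases i <;> fin_cases j <;> norm_num [qSmall, Matrix.mul_apply]

lemma p_herm : pSmallᴴ = pSmall := by
  ext i j; fin_cases i <;> fin_cases j <;> simp [pSmall]

lemma q_herm : qSmallᴴ = qSmall := by
  ext i j; fin_cases i <;> fin_cases j <;> simp [qSmall]

lemma pq_not : ¬ Commute qSmall pSmall := by
  intro h
  have := congrFun (congrFun h.eq 0) 1
  simp [qSmall, pSmall, Matrix.mul_apply] at this

lemma proj_herm (k r : ℕ) : (projMat k r)ᴴ = projMat k r := by
  ext x y
  simp only [projMat, conjTranspose_apply, Matrix.of_apply]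
  rw [apply_ite star, star_one, star_zero]
  exact if_congr and_comm rfl rfl

lemma P_sq (k : ℕ) : P k * P k = P k := by
  rw [P, kron_eq, ← blockDiagonal_mul]
  congr 1; ext1 x; split_ifs <;> simp [p_sq]

lemma Q_sq (k : ℕ) : Q k * Q k = Q k := by
  rw [Q, kron_eq, ← blockDiagonal_mul]
  congr 1; ext1 x; split_ifs <;> simp [q_sq]

lemma P_herm (k : ℕ) : (P k)ᴴ = P k := by
  rw [P, conjTranspose_kronecker, p_herm, proj_herm]

lemma Q_herm (k : ℕ) : (Q k)ᴴ = Q k := by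
  rw [Q, conjTranspose_kronecker, q_herm, proj_herm]

lemma U_cases (k : ℕ) (i j : Fin (k + 3)) :
    U k i j = 0 ∨ U k i j = P k ∨ U k i j = 1 - P k ∨ U k i j = Q k ∨ U k i j = 1 - Q k ∨
      ∃ m, m + 1 < k ∧ U k i j = V k m := by
  unfold U
  split_ifs with h1 h2 <;> try simp
  right; right; right; right; right
  exact ⟨i.val, by omega, rfl⟩

lemma U_symm (k : ℕ) (i j : Fin (k + 3)) : U k i j = U k j i := by
  have hi := i.isLt
  have hj := j.isLt
  unfold U
  simp only [Fin.ext_iff]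
  split_ifs <;> first | rfl | omega | (congr 1)

/-- The invariant. -/
def Good (k L : ℕ) (M : Mk k) : Prop :=
  ∃ A : Fin k → Matrix (Fin 2) (Fin 2) ℂ, M = blockDiagonal A ∧
    (∀ r : Fin k, r.val + L < k → Commute (A r) pSmall) ∧
    (∀ r : Fin k, L ≤ r.val → Commute (A r) qSmall)

lemma sand {R : Type*} [Ring R] (p a : R) (h : p * p = p) :
    Commute (p * a * p) p ∧ Commute ((1 - p) * a * (1 - p)) p := by
  have h1 : p * (1 - p) = 0 := by rw [mul_sub, h, mul_one, sub_self]
  have h2 : (1 - p) * p = 0 := by rw [sub_mul, h, one_mul, sub_self]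
  constructor
  · show p * a * p * p = p * (p * a * p)
    rw [mul_assoc (p * a), h, ← mul_assoc, ← mul_assoc, h]
  · show (1 - p) * a * (1 - p) * p = p * ((1 - p) * a * (1 - p))
    rw [mul_assoc _ _ p, h2, ← mul_assoc, ← mul_assoc, h1]
    simp

lemma good_P (k L : ℕ) (M : Mk k) (h : Good k L M) :
    Good k (L + 1) (P k * M * P k) ∧ Good k (L + 1) ((1 - P k) * M * (1 - P k)) := by
  obtain ⟨A, rfl, hp, hq⟩ := h
  rw [P, kron_eq, one_sub_bd]
  simp only [← blockDiagonal_mul]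
  refine ⟨⟨_, rfl, ?_, ?_⟩, ⟨_, rfl, ?_, ?_⟩⟩
  · intro r hr
    split_ifs
    · exact (sand _ _ p_sq).1
    · simp
  · intro r hr
    rw [if_neg (by omega)]
    simp
  · intro r hr
    split_ifs
    · exact (sand _ _ p_sq).2
    · simpa using hp r (by omega)
  · intro r hr
    rw [if_neg (by omega)]
    simpa using hq r (by omega)

lemma good_Q (k L : ℕ) (M : Mk k) (h : Good k L M) :
    Good k (L + 1) (Q k * M * Q k) ∧ Good k (L + 1) ((1 - Q k) * M * (1 - Q k)) := by
  obtain ⟨A, rfl, hp, hq⟩ := h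
  rw [Q, kron_eq, one_sub_bd]
  simp only [← blockDiagonal_mul]
  refine ⟨⟨_, rfl, ?_, ?_⟩, ⟨_, rfl, ?_, ?_⟩⟩
  · intro r hr
    rw [if_neg (by omega)]
    simp
  · intro r hr
    split_ifs
    · exact (sand _ _ q_sq).1
    · simp
  · intro r hr
    rw [if_neg (by omega)]
    simpa using hp r (by omega)
  · intro r hr
    split_ifs
    · exact (sand _ _ q_sq).2
    · simpa using hq r (by omega)

lemma good_V (k L m : ℕ) (hm : m + 1 < k) (M : Mk k) (h : Good k L M) :
    Good k (L + 1) (V k m * M * V k m) := by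
  obtain ⟨A, rfl, hp, hq⟩ := h
  refine ⟨_, V_conj k m hm A, ?_, ?_⟩
  · intro r hr
    apply hp
    rw [sw_val]
    split_ifs <;> omega
  · intro r hr
    apply hq
    rw [sw_val]
    split_ifs <;> omega

lemma good_nest (k : ℕ) (rest : List (Fin (k + 3) × Fin (k + 3))) :
    Good k rest.length (nest k (rest.map fun t => U k t.1 t.2)) := by
  induction rest with
  | nil =>
    refine ⟨1, ?_, ?_, ?_⟩
    · simp [nest]
    · intro r _; exact Commute.one_left _
    · intro r _; exact Commute.one_left _
  | cons t ts ih =>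
    simp only [List.map_cons, nest, List.length_cons]
    rcases U_cases k t.1 t.2 with h | h | h | h | h | ⟨m, hm, h⟩ <;> rw [h]
    · refine ⟨0, by simp, ?_, ?_⟩
      · intro r _; exact Commute.zero_left _
      · intro r _; exact Commute.zero_left _
    · exact (good_P k _ _ ih).1
    · exact (good_P k _ _ ih).2
    · exact (good_Q k _ _ ih).1
    · exact (good_Q k _ _ ih).2
    · exact good_V k _ m hm _ ih

lemma good_comm (k L : ℕ) (hL : L + 1 ≤ k) (M : Mk k) (h : Good k L M) :
    Commute M (P k) ∧ Commute M (Q k) := by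
  obtain ⟨A, rfl, hp, hq⟩ := h
  rw [P, Q, kron_eq, kron_eq]
  constructor
  · show _ * _ = _ * _
    rw [← blockDiagonal_mul, ← blockDiagonal_mul]
    congr 1; ext1 r
    split_ifs with h0
    · exact hp r (by omega)
    · simp
  · show _ * _ = _ * _
    rw [← blockDiagonal_mul, ← blockDiagonal_mul]
    congr 1; ext1 r
    split_ifs with h0
    · exact hq r (by omega)
    · simp

lemma row_sum (k : ℕ) (hk : 2 ≤ k) (i : Fin (k + 3)) : (∑ m, U k i m ^ 2) = 1 := by
  have e1 : ∀ p : Mk k, p * p = p → p ^ 2 + (1 - p) ^ 2 = 1 := by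
    intro p hp
    have : (1 - p) * (1 - p) = 1 - p := by simp [mul_sub, sub_mul, hp]
    rw [sq, sq, this, hp]; abel
  have e2 : ∀ p : Mk k, p * p = p → (1 - p) ^ 2 + p ^ 2 = 1 := by
    intro p hp
    rw [add_comm]; exact e1 p hp
  have hi := i.isLt
  rcases (by omega : i.val < k - 1 ∨ i.val = k - 1 ∨ i.val = k ∨ i.val = k + 1 ∨ i.val = k + 2)
    with h | h | h | h | h
  · rw [Fintype.sum_eq_single i]
    · simp only [U, h, if_true]
      rw [sq, V_sq k _ (by omega)]
    · intro x hx
      simp [U, h, hx]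
  · have hne : (⟨k - 1, by omega⟩ : Fin (k + 3)) ≠ ⟨k, by omega⟩ := by
      simp only [ne_eq, Fin.ext_iff]; omega
    have hz : ∀ x : Fin (k + 3), x ≠ ⟨k - 1, by omega⟩ ∧ x ≠ ⟨k, by omega⟩ →
        U k i x ^ 2 = 0 := by
      rintro x ⟨h1, h2⟩
      simp only [ne_eq, Fin.ext_iff] at h1 h2
      have h0 : U k i x = 0 := by
        unfold U
        split_ifs <;> first | omega | rfl
      rw [h0, sq, mul_zero]
    rw [Fintype.sum_eq_add _ _ hne hz]
    have ha : U k i ⟨k - 1, by omega⟩ = P k := by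
      unfold U
      dsimp only
      split_ifs <;> first | omega | rfl
    have hb : U k i ⟨k, by omega⟩ = 1 - P k := by
      unfold U
      dsimp only
      split_ifs <;> first | omega | rfl
    rw [ha, hb]
    exact e1 _ (P_sq k)
  · have hne : (⟨k - 1, by omega⟩ : Fin (k + 3)) ≠ ⟨k, by omega⟩ := by
      simp only [ne_eq, Fin.ext_iff]; omega
    have hz : ∀ x : Fin (k + 3), x ≠ ⟨k - 1, by omega⟩ ∧ x ≠ ⟨k, by omega⟩ →
        U k i x ^ 2 = 0 := by
      rintro x ⟨h1, h2⟩
      simp only [ne_eq, Fin.ext_iff] at h1 h2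
      have h0 : U k i x = 0 := by
        unfold U
        split_ifs <;> first | omega | rfl
      rw [h0, sq, mul_zero]
    rw [Fintype.sum_eq_add _ _ hne hz]
    have ha : U k i ⟨k - 1, by omega⟩ = 1 - P k := by
      unfold U
      dsimp only
      split_ifs <;> first | omega | rfl
    have hb : U k i ⟨k, by omega⟩ = P k := by
      unfold U
      dsimp only
      split_ifs <;> first | omega | rfl
    rw [ha, hb]
    exact e2 _ (P_sq k)
  · have hne : (⟨k + 1, by omega⟩ : Fin (k + 3)) ≠ ⟨k + 2, by omega⟩ := by
      simp only [ne_eq, Fin.ext_iff]; omega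
    have hz : ∀ x : Fin (k + 3), x ≠ ⟨k + 1, by omega⟩ ∧ x ≠ ⟨k + 2, by omega⟩ →
        U k i x ^ 2 = 0 := by
      rintro x ⟨h1, h2⟩
      simp only [ne_eq, Fin.ext_iff] at h1 h2
      have h0 : U k i x = 0 := by
        unfold U
        split_ifs <;> first | omega | rfl
      rw [h0, sq, mul_zero]
    rw [Fintype.sum_eq_add _ _ hne hz]
    have ha : U k i ⟨k + 1, by omega⟩ = Q k := by
      unfold U
      dsimp only
      split_ifs <;> first | omega | rfl
    have hb : U k i ⟨k + 2, by omega⟩ = 1 - Q k := by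
      unfold U
      dsimp only
      split_ifs <;> first | omega | rfl
    rw [ha, hb]
    exact e1 _ (Q_sq k)
  · have hne : (⟨k + 1, by omega⟩ : Fin (k + 3)) ≠ ⟨k + 2, by omega⟩ := by
      simp only [ne_eq, Fin.ext_iff]; omega
    have hz : ∀ x : Fin (k + 3), x ≠ ⟨k + 1, by omega⟩ ∧ x ≠ ⟨k + 2, by omega⟩ →
        U k i x ^ 2 = 0 := by
      rintro x ⟨h1, h2⟩
      simp only [ne_eq, Fin.ext_iff] at h1 h2
      have h0 : U k i x = 0 := by
        unfold U
        split_ifs <;> first | omega | rfl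
      rw [h0, sq, mul_zero]
    rw [Fintype.sum_eq_add _ _ hne hz]
    have ha : U k i ⟨k + 1, by omega⟩ = 1 - Q k := by
      unfold U
      dsimp only
      split_ifs <;> first | omega | rfl
    have hb : U k i ⟨k + 2, by omega⟩ = Q k := by
      unfold U
      dsimp only
      split_ifs <;> first | omega | rfl
    rw [ha, hb]
    exact e2 _ (Q_sq k)

lemma row_orth (k : ℕ) (i j m : Fin (k + 3)) (hij : i ≠ j) : U k m i * U k m j = 0 := by
  have hP1 : P k * (1 - P k) = 0 := by rw [mul_sub, P_sq, mul_one, sub_self]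
  have hP2 : (1 - P k) * P k = 0 := by rw [sub_mul, P_sq, one_mul, sub_self]
  have hQ1 : Q k * (1 - Q k) = 0 := by rw [mul_sub, Q_sq, mul_one, sub_self]
  have hQ2 : (1 - Q k) * Q k = 0 := by rw [sub_mul, Q_sq, one_mul, sub_self]
  simp only [ne_eq, Fin.ext_iff] at hij
  unfold U
  simp only [Fin.ext_iff]
  split_ifs <;> first | omega | assumption | exact mul_zero _ | exact zero_mul _

/-- The word `V_s V_{s+1} ⋯ V_{k-2} Q`. -/
lemma word (k : ℕ) (hk : 2 ≤ k) (d : ℕ) (hd : d + 1 ≤ k) :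
    ∃ rest : List (Fin (k + 3) × Fin (k + 3)), rest.length = d + 1 ∧
      nest k (rest.map fun t => U k t.1 t.2) =
        blockDiagonal (fun x : Fin k => if x.val = k - 1 - d then qSmall else 0) := by
  induction d with
  | zero =>
    refine ⟨[(⟨k + 1, by omega⟩, ⟨k + 1, by omega⟩)], rfl, ?_⟩
    have : U k ⟨k + 1, by omega⟩ ⟨k + 1, by omega⟩ = Q k := by
      unfold U
      dsimp only
      split_ifs <;> first | omega | rfl
    simp only [List.map_cons, List.map_nil, nest, mul_one, this, Q_sq]
    rw [Q, kron_eq]; rfl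
  | succ d ih =>
    obtain ⟨rest, hl, hr⟩ := ih (by omega)
    refine ⟨(⟨k - 2 - d, by omega⟩, ⟨k - 2 - d, by omega⟩) :: rest, by simp [hl], ?_⟩
    have : U k ⟨k - 2 - d, by omega⟩ ⟨k - 2 - d, by omega⟩ = V k (k - 2 - d) := by
      unfold U
      dsimp only
      rw [if_pos (by omega), if_pos rfl]
    simp only [List.map_cons, nest, this, hr]
    rw [V_conj k _ (by omega)]
    congr 1; ext1 x
    refine if_congr ?_ rfl rfl
    rw [sw_val]
    split_ifs <;> omega

theorem statement19 (k : ℕ) (hk : 2 ≤ k) :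
    (∀ i j, (U k i j)ᴴ = U k i j) ∧
    (∀ i j m, i ≠ j → U k i m * U k j m = 0 ∧ U k m i * U k m j = 0) ∧
    (∀ i, (∑ m, U k i m ^ 2) = 1 ∧ (∑ m, U k m i ^ 2) = 1) ∧
    (∀ rest : List (Fin (k + 3) × Fin (k + 3)),
      1 ≤ rest.length → rest.length ≤ k - 1 → ∀ i₁ j₁ : Fin (k + 3),
        Commute (nest k (rest.map fun t => U k t.1 t.2)) (U k i₁ j₁ ^ 2)) ∧
    (∃ rest : List (Fin (k + 3) × Fin (k + 3)), rest.length = k ∧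
      ∃ i₁ j₁ : Fin (k + 3),
        ¬ Commute (nest k (rest.map fun t => U k t.1 t.2)) (U k i₁ j₁ ^ 2)) := by
  refine ⟨?_, ?_, ?_, ?_, ?_⟩
  · intro i j
    rcases U_cases k i j with h | h | h | h | h | ⟨m, hm, h⟩ <;> rw [h]
    · simp
    · exact P_herm k
    · rw [conjTranspose_sub, P_herm, conjTranspose_one]
    · exact Q_herm k
    · rw [conjTranspose_sub, Q_herm, conjTranspose_one]
    · exact V_herm k m
  · intro i j m hij
    refine ⟨?_, row_orth k i j m hij⟩
    rw [U_symm k i m, U_symm k j m]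
    exact row_orth k i j m hij
  · intro i
    refine ⟨row_sum k hk i, ?_⟩
    simp only [U_symm k _ i]
    exact row_sum k hk i
  · intro rest h1 h2 i j
    obtain ⟨cP, cQ⟩ := good_comm k rest.length (by omega) _ (good_nest k rest)
    rcases U_cases k i j with h | h | h | h | h | ⟨m, hm, h⟩ <;> rw [h]
    · simp
    · exact cP.pow_right 2
    · exact ((Commute.one_right _).sub_right cP).pow_right 2
    · exact cQ.pow_right 2
    · exact ((Commute.one_right _).sub_right cQ).pow_right 2
    · rw [sq, V_sq k m hm]; exact Commute.one_right _
  · obtain ⟨rest, hl, hr⟩ := word k hk (k - 1) (by omega)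
    refine ⟨rest, by omega, ⟨k - 1, by omega⟩, ⟨k - 1, by omega⟩, ?_⟩
    have : U k ⟨k - 1, by omega⟩ ⟨k - 1, by omega⟩ = P k := by
      unfold U
      dsimp only
      rw [if_neg (by omega), if_pos rfl, if_pos rfl]
    rw [this, hr, sq, P_sq, P, kron_eq]
    intro h
    have h2 := h.eq
    rw [← blockDiagonal_mul, ← blockDiagonal_mul] at h2
    have h3 := congrFun (blockDiagonal_injective h2) ⟨0, by omega⟩
    simp only [Nat.sub_self, if_true] at h3
    exact pq_not h3

end EasyQG19
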